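/- arXiv:2502.12285 — 12 statements merged into one kernel-verified Lean document; each statement's English description precedes it below -/
import Mathlib

section
/- Let E be a finite-dimensional real inner product space, let m ≥ 2, let A_1,…,A_m be nonempty closed subsets of E with A_{m+1} := A_1, and let λ ∈ [0,1). Let x ∈ E and suppose points x_{m+1}, x_m, …, x_1 and p_{j+1}, q_j (j = 1,…,m) are given by the backward recursion: x_{m+1} := x, and for j = m down to 1, p_{j+1} ∈ P_{A_{j+1}}(x_{j+1}), q_j ∈ P_{A_j}(2p_{j+1} − x_{j+1}), and x_j := λ·q_j + (1 − 2λ)·p_{j+1} + λ·x_{j+1} (the value of the relaxed Douglas–Rachford step T_{j,j+1} applied to x_{j+1}). Then x_1 = x if and only if x = Σ_{j=1}^m [ (λ^j/(1 − λ^m))·q_j + ((1 − 2λ)λ^{j−1}/(1 − λ^m))·p_{j+1} ]. Moreover the coefficients sum to one: Σ_{j=1}^m [ λ^j/(1 − λ^m) + (1 − 2λ)λ^{j−1}/(1 − λ^m) ] = 1, and if in addition λ ∈ [0,1/2] then all the coefficients λ^j/(1 − λ^m) and (1 − 2λ)λ^{j−1}/(1 − λ^m) are nonnegative. -/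
noncomputable section

/-- The (possibly set-valued) metric projector onto `A`. -/
def projSet {E : Type*} [NormedAddCommGroup E] (A : Set E) (x : E) : Set E :=
  {a | a ∈ A ∧ ∀ b ∈ A, ‖x - a‖ ≤ ‖x - b‖}

/-- Unrolling of an affine backward recursion with constant rate `c`. -/
theorem backward_recursion_unroll {E : Type*} [AddCommGroup E] [Module ℝ E] {m : ℕ} {c : ℝ}
    {u v : ℕ → E} (h : ∀ j ∈ Finset.Icc 1 m, u j = v j + c • u (j + 1)) :
    u 1 = ∑ j ∈ Finset.Icc 1 m, c ^ (j - 1) • v j + c ^ m • u (m + 1) := by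
  induction m with
  | zero => simp
  | succ k ih =>
    have hk := h (k + 1) (by simp)
    rw [ih fun j hj => h j (Finset.Icc_subset_Icc_right k.le_succ hj),
      Finset.sum_Icc_succ_top (by omega), hk, Nat.add_sub_cancel, pow_succ]
    module

/-- The coefficients of the unrolled relaxed Douglas–Rachford recursion form a geometric sum. -/
theorem sum_relaxed_coeff (c : ℝ) (m : ℕ) :
    ∑ j ∈ Finset.Icc 1 m, (c ^ j + (1 - 2 * c) * c ^ (j - 1)) = 1 - c ^ m := by
  induction m with
  | zero => simp
  | succ k ih =>
    rw [Finset.sum_Icc_succ_top (by omega), ih, Nat.add_sub_cancel]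
    ring

/-- characterization of fixed points of the cyclic relaxed Douglas–Rachford
mapping for `λ ∈ [0,1)` as certain convex-like combinations of points in the sets. -/
theorem stmt1
    {E : Type*} [NormedAddCommGroup E] [InnerProductSpace ℝ E] [FiniteDimensional ℝ E]
    (m : ℕ) (hm : 2 ≤ m)
    (A : ℕ → Set E)
    (hA : ∀ j ∈ Finset.Icc 1 (m+1), (A j).Nonempty ∧ IsClosed (A j))
    (hAper : A (m+1) = A 1)
    (lam : ℝ) (hlam : lam ∈ Set.Ico (0:ℝ) 1)
    (x : E) (xs p q : ℕ → E)
    (hxm : xs (m+1) = x)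
    (hp : ∀ j ∈ Finset.Icc 1 m, p (j+1) ∈ projSet (A (j+1)) (xs (j+1)))
    (hq : ∀ j ∈ Finset.Icc 1 m, q j ∈ projSet (A j) ((2:ℝ) • p (j+1) - xs (j+1)))
    (hrec : ∀ j ∈ Finset.Icc 1 m,
      xs j = lam • q j + (1 - 2*lam) • p (j+1) + lam • xs (j+1)) :
    (xs 1 = x ↔
      x = ∑ j ∈ Finset.Icc 1 m,
        ((lam^j / (1 - lam^m)) • q j
          + ((1 - 2*lam) * lam^(j-1) / (1 - lam^m)) • p (j+1)))
    ∧ (∑ j ∈ Finset.Icc 1 m,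
        (lam^j / (1 - lam^m) + (1 - 2*lam) * lam^(j-1) / (1 - lam^m)) = 1)
    ∧ (lam ≤ 1/2 → ∀ j ∈ Finset.Icc 1 m,
        0 ≤ lam^j / (1 - lam^m) ∧ 0 ≤ (1 - 2*lam) * lam^(j-1) / (1 - lam^m)) := by
  obtain ⟨h0, h1⟩ := hlam
  have hpos : 0 < 1 - lam ^ m := sub_pos.mpr (pow_lt_one₀ h0 h1 (by omega))
  refine ⟨?_, ?_, ?_⟩
  · have hunroll := backward_recursion_unroll hrec
    rw [hxm] at hunroll
    have hsum : ∑ j ∈ Finset.Icc 1 m,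
        ((lam^j / (1 - lam^m)) • q j + ((1 - 2*lam) * lam^(j-1) / (1 - lam^m)) • p (j+1))
        = (1 - lam ^ m)⁻¹ •
          ∑ j ∈ Finset.Icc 1 m, lam ^ (j - 1) • (lam • q j + (1 - 2*lam) • p (j+1)) := by
      rw [Finset.smul_sum]
      refine Finset.sum_congr rfl fun j hj => ?_
      rw [← pow_sub_one_mul (Nat.one_le_iff_ne_zero.mp (Finset.mem_Icc.mp hj).1) lam]
      module
    rw [hsum, hunroll, eq_inv_smul_iff₀ hpos.ne', sub_smul, one_smul, sub_eq_iff_eq_add, eq_comm]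
  · simp only [← add_div]
    rw [← Finset.sum_div, sum_relaxed_coeff, div_self hpos.ne']
  · intro hle j _
    have hc : 0 ≤ 1 - 2 * lam := by linarith
    exact ⟨by positivity, by positivity⟩
end
end

section
/- Let E be a finite-dimensional real inner product space, let m ≥ 2, let A_1,…,A_m be nonempty closed subsets of E with A_{m+1} := A_1, and let λ ∈ [0,1/2]. Let x ∈ E and suppose points x_{m+1}, x_m, …, x_1 and p_{j+1}, q_j (j = 1,…,m) are given by the backward recursion: x_{m+1} := x, and for j = m down to 1, p_{j+1} ∈ P_{A_{j+1}}(x_{j+1}), q_j ∈ P_{A_j}(2p_{j+1} − x_{j+1}), and x_j := λ·q_j + (1 − 2λ)·p_{j+1} + λ·x_{j+1}. If x_1 = x (i.e., x is a fixed point of the cyclic relaxed Douglas–Rachford mapping along this chain), then x lies in the convex hull of the union A_1 ∪ A_2 ∪ … ∪ A_m. -/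
noncomputable section

/-- A nonnegative combination of two points of a convex set is a multiple of a point of it. -/
theorem Convex.exists_smul_add_smul_eq {E : Type*} [AddCommGroup E] [Module ℝ E] {C : Set E}
    (hC : Convex ℝ C) {a b : E} (ha : a ∈ C) (hb : b ∈ C) {s t : ℝ} (hs : 0 ≤ s) (ht : 0 ≤ t) :
    ∃ c ∈ C, s • a + t • b = (s + t) • c := by
  open Pointwise in
  have h : s • a + t • b ∈ (s + t) • C := by
    rw [hC.add_smul hs ht]
    exact Set.add_mem_add (Set.smul_mem_smul_set ha) (Set.smul_mem_smul_set hb)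
  obtain ⟨c, hc, h⟩ := Set.mem_smul_set.mp h
  exact ⟨c, hc, h.symm⟩

/-- for `λ ∈ [0,1/2]`, fixed points of the cyclic relaxed Douglas–Rachford
mapping lie in the convex hull of the union of the sets. -/
theorem stmt3
    {E : Type*} [NormedAddCommGroup E] [InnerProductSpace ℝ E] [FiniteDimensional ℝ E]
    (m : ℕ) (hm : 2 ≤ m)
    (A : ℕ → Set E)
    (hA : ∀ j ∈ Finset.Icc 1 (m+1), (A j).Nonempty ∧ IsClosed (A j))
    (hAper : A (m+1) = A 1)
    (lam : ℝ) (hlam : lam ∈ Set.Icc (0:ℝ) (1/2))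
    (x : E) (xs p q : ℕ → E)
    (hxm : xs (m+1) = x)
    (hp : ∀ j ∈ Finset.Icc 1 m, p (j+1) ∈ projSet (A (j+1)) (xs (j+1)))
    (hq : ∀ j ∈ Finset.Icc 1 m, q j ∈ projSet (A j) ((2:ℝ) • p (j+1) - xs (j+1)))
    (hrec : ∀ j ∈ Finset.Icc 1 m,
      xs j = lam • q j + (1 - 2*lam) • p (j+1) + lam • xs (j+1))
    (hfix : xs 1 = x) :
    x ∈ convexHull ℝ (⋃ i ∈ Finset.Icc 1 m, A i) := by
  set C := convexHull ℝ (⋃ i ∈ Finset.Icc 1 m, A i) with hCdef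
  have hC : Convex ℝ C := convex_convexHull ℝ _
  obtain ⟨h0, h1⟩ := hlam
  have hsub : ∀ j ∈ Finset.Icc 1 m, A j ⊆ C := fun j hj =>
    (Set.subset_biUnion_of_mem (u := A) (Finset.mem_coe.mpr hj)).trans (subset_convexHull ℝ _)
  have hqC : ∀ j ∈ Finset.Icc 1 m, q j ∈ C := fun j hj => hsub j hj (hq j hj).1
  have hpC : ∀ j ∈ Finset.Icc 1 m, p (j + 1) ∈ C := by
    intro j hj
    have hpA := (hp j hj).1
    rcases eq_or_ne j m with rfl | hne
    · rw [hAper] at hpA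
      exact hsub 1 (Finset.mem_Icc.mpr ⟨le_rfl, by omega⟩) hpA
    · rw [Finset.mem_Icc] at hj
      exact hsub (j + 1) (Finset.mem_Icc.mpr ⟨by omega, by omega⟩) hpA
  have key : ∀ k j, j + k = m + 1 → 1 ≤ j →
      ∃ c ∈ C, xs j = lam ^ k • x + (1 - lam ^ k) • c := by
    intro k
    induction k with
    | zero =>
      intro j hj _
      obtain rfl : j = m + 1 := by omega
      exact ⟨q 1, hqC 1 (Finset.mem_Icc.mpr ⟨le_rfl, by omega⟩), by simp [hxm]⟩
    | succ k ih =>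
      intro j hj hj1
      obtain ⟨c, hc, hxc⟩ := ih (j + 1) (by omega) (by omega)
      have hjm : j ∈ Finset.Icc 1 m := Finset.mem_Icc.mpr ⟨hj1, by omega⟩
      have hpow : lam ^ k ≤ 1 := pow_le_one₀ h0 (by linarith)
      obtain ⟨d, hd, hqp⟩ := hC.exists_smul_add_smul_eq (hqC j hjm) (hpC j hjm)
        h0 (by linarith : 0 ≤ 1 - 2 * lam)
      obtain ⟨e, he, hdc⟩ := hC.exists_smul_add_smul_eq hd hc
        (by linarith : 0 ≤ lam + (1 - 2 * lam)) (mul_nonneg h0 (sub_nonneg.mpr hpow))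
      refine ⟨e, he, ?_⟩
      have hcoef : 1 - lam ^ (k + 1) = lam + (1 - 2 * lam) + lam * (1 - lam ^ k) := by ring
      rw [hrec j hjm, hxc, hqp, hcoef, ← hdc]
      module
  obtain ⟨c, hc, hxc⟩ := key m 1 (by omega) le_rfl
  rw [hfix] at hxc
  have hlt : lam ^ m < 1 := pow_lt_one₀ h0 (by linarith) (by omega)
  have hsmul : (1 - lam ^ m) • x = (1 - lam ^ m) • c := by
    rw [sub_smul, one_smul, sub_eq_iff_eq_add']
    exact hxc
  rwa [smul_right_injective E (sub_pos.mpr hlt).ne' hsmul]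
end
end

section
/- Let E be a finite-dimensional real inner product space, let m ≥ 2, and let A_1,…,A_m be nonempty affine subspaces of E with A_{m+1} := A_1. For each j let π_j : E → E denote the (single-valued) metric projection onto A_j, i.e., π_j(x) is the unique nearest point of x in A_j. Let λ ∈ [0,1] and define T_{j,j+1}(x) := λ·π_j(2π_{j+1}(x) − x) + (1 − 2λ)·π_{j+1}(x) + λ·x and T := T_{1,2} ∘ T_{2,3} ∘ … ∘ T_{m,m+1}. If x ∈ E satisfies T(x) = x, then π_1(x) is a fixed point of the extended cyclic projections map T_CP := π_1 ∘ π_2 ∘ … ∘ π_m ∘ π_1, i.e., π_1(π_2(⋯π_m(π_1(π_1(x)))⋯)) = π_1(x). -/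
noncomputable section

/-- A nearest-point map onto an affine subspace is an idempotent affine map. -/
theorem exists_affineMap_of_isNearest
    {E : Type*} [NormedAddCommGroup E] [InnerProductSpace ℝ E] [FiniteDimensional ℝ E]
    (A : AffineSubspace ℝ E) (p : E → E)
    (hp : ∀ x : E, p x ∈ A ∧ ∀ b ∈ (A : Set E), ‖x - p x‖ ≤ ‖x - b‖) :
    ∃ f : E →ᵃ[ℝ] E, (∀ x, p x = f x) ∧ ∀ x, f (f x) = f x := by
  have : Nonempty A := ⟨⟨p 0, (hp 0).1⟩⟩
  refine ⟨A.subtype.comp (EuclideanGeometry.orthogonalProjection A).toAffineMap,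
    fun x => ?_, fun x => ?_⟩
  · change p x = (EuclideanGeometry.orthogonalProjection A x : E)
    have hsq :=
      EuclideanGeometry.dist_sq_eq_dist_orthogonalProjection_sq_add_dist_orthogonalProjection_sq
        x (hp x).1
    have hle := (hp x).2 _ (EuclideanGeometry.orthogonalProjection_mem x)
    rw [← dist_eq_norm, ← dist_eq_norm, dist_comm x (p x)] at hle
    refine dist_eq_zero.1 (mul_self_eq_zero.1 (le_antisymm ?_ (mul_self_nonneg _)))
    linarith [mul_self_le_mul_self dist_nonneg hle]
  · change (EuclideanGeometry.orthogonalProjection A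
      (EuclideanGeometry.orthogonalProjection A x : E) : E) = _
    rw [EuclideanGeometry.orthogonalProjection_orthogonalProjection]
    rfl

/-- An idempotent affine map sends the relaxed Douglas–Rachford combination of `b` and `z`
to its value at `b`. -/
theorem AffineMap.apply_relaxed_douglasRachford
    {E : Type*} [AddCommGroup E] [Module ℝ E] (f : E →ᵃ[ℝ] E) (hf : ∀ x, f (f x) = f x)
    (c : ℝ) (b z : E) :
    f (c • f ((2 : ℝ) • b - z) + (1 - 2 * c) • b + c • z) = f b := by
  have hdec : ∀ y, f y = f.linear y + f 0 := fun y => congrFun f.decomp y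
  have hlin : ∀ y, f.linear (f y) = f.linear y := fun y => by
    have h := hf y
    rw [hdec (f y)] at h
    nth_rw 2 [hdec y] at h
    exact add_right_cancel h
  rw [hdec, hdec b]
  simp only [map_add, map_smul, hlin, map_sub]
  module

/-- If `P k ∘ T k = P k ∘ P (k + 1)` for all `k < n`, then
`P 0 ∘ T 0 ∘ ⋯ ∘ T (n - 1) = P 0 ∘ ⋯ ∘ P n`. -/
theorem foldr_comp_of_shadow {α : Type*} (n : ℕ) (P T : ℕ → α → α)
    (h : ∀ k < n, ∀ z, P k (T k z) = P k (P (k + 1) z)) (z : α) :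
    P 0 (((List.range n).map T).foldr (· ∘ ·) id z) =
      ((List.range n).map P).foldr (· ∘ ·) id (P n z) := by
  induction n generalizing P T with
  | zero => rfl
  | succ n ih =>
    have := ih (fun k => P (k + 1)) (fun k => T (k + 1)) fun k hk => h (k + 1) (by omega)
    simp only [List.range_succ_eq_map, List.map_cons, List.map_map, List.foldr_cons,
      Function.comp_apply]
    rw [h 0 (by omega)]
    exact congrArg (P 0) this

/-- for affine subspaces, the shadow `π₁(x)` of a fixed point `x` of the cyclic
relaxed Douglas–Rachford mapping is a fixed point of the extended cyclic projections map
`π₁ ∘ π₂ ∘ … ∘ π_m ∘ π₁`. -/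
theorem stmt5
    {E : Type*} [NormedAddCommGroup E] [InnerProductSpace ℝ E] [FiniteDimensional ℝ E]
    (m : ℕ) (hm : 2 ≤ m)
    (A : ℕ → AffineSubspace ℝ E)
    (hA : ∀ j ∈ Finset.Icc 1 (m+1), (A j : Set E).Nonempty)
    (hAper : A (m+1) = A 1)
    (pi : ℕ → E → E)
    (hpi : ∀ j ∈ Finset.Icc 1 (m+1), ∀ x : E,
      pi j x ∈ A j ∧ ∀ b ∈ (A j : Set E), ‖x - pi j x‖ ≤ ‖x - b‖)
    (hpiper : pi (m+1) = pi 1)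
    (lam : ℝ) (hlam : lam ∈ Set.Icc (0:ℝ) 1)
    (x : E)
    (hfix : ((List.range m).map (fun k => fun z : E =>
        lam • pi (k+1) ((2:ℝ) • pi (k+2) z - z) + (1 - 2*lam) • pi (k+2) z + lam • z)).foldr
        (· ∘ ·) id x = x) :
    ((List.range m).map (fun k => pi (k+1))).foldr (· ∘ ·) id (pi 1 (pi 1 x)) = pi 1 x := by
  have key : ∀ j ∈ Finset.Icc 1 (m + 1),
      ∃ f : E →ᵃ[ℝ] E, (∀ y, pi j y = f y) ∧ ∀ y, f (f y) = f y := fun j hj =>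
    exists_affineMap_of_isNearest (A j) (pi j) (hpi j hj)
  have hidem : pi 1 (pi 1 x) = pi 1 x := by
    obtain ⟨f, hf, hff⟩ := key 1 (by simp)
    simp only [hf, hff]
  have hshadow := foldr_comp_of_shadow m (fun k => pi (k + 1))
    (fun k => fun z : E =>
      lam • pi (k+1) ((2:ℝ) • pi (k+2) z - z) + (1 - 2*lam) • pi (k+2) z + lam • z)
    (fun k hk z => by
      obtain ⟨f, hf, hff⟩ := key (k + 1) (Finset.mem_Icc.2 ⟨by omega, by omega⟩)
      simp only [hf]
      exact f.apply_relaxed_douglasRachford hff lam _ z) x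
  rw [hfix] at hshadow
  simp only [hpiper, zero_add] at hshadow
  rw [hidem]
  exact hshadow.symm
end
end

section
/- Let E be a finite-dimensional real inner product space. Let T_1, T_2 : E ⇉ E be set-valued mappings, let Φ_1, Φ_2 : E → E be affine maps, let ε_1 > 0 and 0 < ε_2 < 1, and let U_1, U_2 ⊆ E. Assume: (a) for i = 1, 2 and all x ∈ U_i and y ∈ T_i(x), ‖y − Φ_i(x)‖ ≤ ε_i; (b) T_2(U_2) ⊆ U_1; and (c) M ≥ 0 is a constant with ‖Φ_1(w)‖ ≤ M for every w ∈ E with ‖w‖ ≤ 1. Then for every x ∈ U_2 and every z ∈ (T_1 ∘ T_2)(x) (i.e., z ∈ T_1(y) for some y ∈ T_2(x)), ‖z − (1 − ε_2)·Φ_1( (1/(1 − ε_2))·Φ_2(x) )‖ ≤ ε_1 + ε_2·M. In other words, T_1 ∘ T_2 is approximated on U_2 by the affine map Φ_{1,2}(x) := (1 − ε_2)Φ_1(Φ_2(x)/(1 − ε_2)) with error ε_1 + ε_2·sup_{‖w‖≤1}‖Φ_1(w)‖. -/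
noncomputable section

/-- composition of two set-valued maps approximated by affine maps is
approximated by an affine map. -/
theorem stmt7
    {E : Type*} [NormedAddCommGroup E] [InnerProductSpace ℝ E] [FiniteDimensional ℝ E]
    (T1 T2 : E → Set E) (Phi1 Phi2 : E →ᵃ[ℝ] E)
    (e1 e2 : ℝ) (he1 : 0 < e1) (he2 : 0 < e2) (he2' : e2 < 1)
    (U1 U2 : Set E)
    (ha1 : ∀ x ∈ U1, ∀ y ∈ T1 x, ‖y - Phi1 x‖ ≤ e1)
    (ha2 : ∀ x ∈ U2, ∀ y ∈ T2 x, ‖y - Phi2 x‖ ≤ e2)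
    (hb : ∀ x ∈ U2, T2 x ⊆ U1)
    (M : ℝ) (hM0 : 0 ≤ M) (hM : ∀ w : E, ‖w‖ ≤ 1 → ‖Phi1 w‖ ≤ M) :
    ∀ x ∈ U2, ∀ y ∈ T2 x, ∀ z ∈ T1 y,
      ‖z - (1 - e2) • Phi1 ((1 / (1 - e2)) • Phi2 x)‖ ≤ e1 + e2 * M := by
  intro x hx y hy z hz
  have hne : 1 - e2 ≠ 0 := (sub_pos.mpr he2').ne'
  set w : E := e2⁻¹ • (y - Phi2 x) with hw
  have hw1 : ‖w‖ ≤ 1 := by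
    rw [hw, norm_smul, norm_inv, Real.norm_of_nonneg he2.le]
    exact inv_mul_le_one_of_le₀ (ha2 x hx y hy) he2.le
  have hy_combo : y = (1 - e2) • ((1 / (1 - e2)) • Phi2 x) + e2 • w := by
    rw [hw, smul_smul, smul_smul, mul_one_div_cancel hne, mul_inv_cancel₀ he2.ne']
    simp
  have hPhi1 : Phi1 y = (1 - e2) • Phi1 ((1 / (1 - e2)) • Phi2 x) + e2 • Phi1 w := by
    conv_lhs => rw [hy_combo]
    exact Convex.combo_affine_apply (sub_add_cancel 1 e2)
  calc ‖z - (1 - e2) • Phi1 ((1 / (1 - e2)) • Phi2 x)‖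
      = ‖(z - Phi1 y) + e2 • Phi1 w‖ := by rw [hPhi1]; congr 1; abel
    _ ≤ ‖z - Phi1 y‖ + ‖e2 • Phi1 w‖ := norm_add_le _ _
    _ ≤ e1 + e2 * M := by
      rw [norm_smul, Real.norm_of_nonneg he2.le]
      exact add_le_add (ha1 y (hb x hx hy) z hz)
        (mul_le_mul_of_nonneg_left (hM w hw1) he2.le)
end
end

section
/- Let E be a finite-dimensional real inner product space, let m ≥ 2, let A_1,…,A_m be nonempty closed subsets of E with A_{m+1} := A_1, and let λ ∈ [0,1]. Assume each projector P_{A_j} is single-valued, with nearest-point map π_j : E → E (π_{m+1} := π_1). Define T_{j,j+1}(x) := λ·π_j(2π_{j+1}(x) − x) + (1 − 2λ)·π_{j+1}(x) + λ·x and T_{i,…,m} := T_{i,i+1} ∘ T_{i+1,i+2} ∘ … ∘ T_{m,m+1}, with T := T_{1,…,m}. Let x ∈ E satisfy T(x) = x, and set x_{m+1} := x and x_i := T_{i,…,m}(x) for i = 1,…,m. Suppose there are sets U_1,…,U_m ⊆ E, affine maps Φ_i : E → E, and constants ε_i ∈ (0,1) such that: (a) ‖π_i(w) − Φ_i(w)‖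 ≤ ε_i for all w ∈ U_i (i = 1,…,m); (b) π_{i+1}(U_{i+1}) ⊆ U_i for i = 1,…,m−1; (c) for each i = 1,…,m, the four points x_i, π_i(2π_{i+1}(x_{i+1}) − x_{i+1}), 2π_{i+1}(x_{i+1}) − x_{i+1}, and π_{i+1}(x_{i+1}) all lie in U_i. Define recursively Φ^{(1)} := Φ_1, Φ^{(i+1)}(z) := (1 − ε_{i+1})·Φ^{(i)}(Φ_{i+1}(z)/(1 − ε_{i+1})), ε^{(1)} := ε_1, and ε^{(i+1)} := ε^{(i)} + ε_{i+1}·M_i, where M_i ≥ 0 satisfies ‖Φ^{(i)}(w)‖ ≤ M_i for all ‖w‖ ≤ 1. Then ‖π_1(x) − (π_1 ∘ π_2 ∘ … ∘ π_m)(π_1(x))‖ ≤ 4·Σ_{i=1}^m ε^{(i)}; that is, the shadow π_1(x) of the fixed point x is an almost fixed point of the cyclic projections map with error 4·Σ_{i=1}^m ε^{(i)}. -/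
noncomputable section

/-- The composition `f 1 ∘ f 2 ∘ ⋯ ∘ f n`. -/
def compUpTo {E : Type*} (f : ℕ → E → E) (n : ℕ) : E → E :=
  ((List.range n).map (fun k => f (k+1))).foldr (· ∘ ·) id

theorem List.foldr_comp_eq {E : Type*} (l : List (E → E)) (g : E → E) :
    l.foldr (· ∘ ·) g = l.foldr (· ∘ ·) id ∘ g := by
  induction l with
  | nil => rfl
  | cons a l ih => simp only [List.foldr_cons, ih, Function.comp_assoc]

theorem compUpTo_succ {E : Type*} (f : ℕ → E → E) (n : ℕ) (z : E) :
    compUpTo f (n+1) z = compUpTo f n (f (n+1) z) := by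
  unfold compUpTo
  rw [List.range_succ, List.map_append, List.foldr_append, List.foldr_comp_eq]
  rfl

theorem compUpTo_one {E : Type*} (f : ℕ → E → E) (z : E) : compUpTo f 1 z = f 1 z := by
  simp [compUpTo]

section

variable {E : Type*} [NormedAddCommGroup E] [InnerProductSpace ℝ E]

/-- Replacing `p` by an `ε`-approximation `q` inside an affine map, with the rescaling by
`1 - ε`, costs at most `ε * M`, where `M` bounds the affine map on the unit ball. -/
theorem norm_affine_sub_rescaled_le {L : E →ₗ[ℝ] E} {c p q : E} {ε M : ℝ}
    (hε : ε ∈ Set.Ioo (0:ℝ) 1) (hM : ∀ w : E, ‖w‖ ≤ 1 → ‖L w + c‖ ≤ M) (hpq : ‖p - q‖ ≤ ε) :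
    ‖(L p + c) - (1 - ε) • (L ((1 / (1 - ε)) • q) + c)‖ ≤ ε * M := by
  obtain ⟨h0, h1⟩ := hε
  have h2 : (1 - ε) ≠ 0 := by linarith
  have key : (L p + c) - (1 - ε) • (L ((1 / (1 - ε)) • q) + c)
      = ε • (L (ε⁻¹ • (p - q)) + c) := by
    rw [map_smul, map_smul, map_sub, smul_add, smul_add, smul_smul, smul_smul,
      mul_one_div_cancel h2, mul_inv_cancel₀ h0.ne']
    module
  rw [key, norm_smul, Real.norm_of_nonneg h0.le]
  refine mul_le_mul_of_nonneg_left (hM _ ?_) h0.le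
  rw [norm_smul, norm_inv, Real.norm_of_nonneg h0.le, inv_mul_le_iff₀ h0, mul_one]
  exact hpq

/-- A map approximated within `δ` by an affine map, and identifying `q` with `y`, nearly
identifies `p + lam • (q - y)` with `p`. -/
theorem norm_sub_le_of_affine_approx {P : E → E} {L : E →ₗ[ℝ] E} {c u p q y : E} {lam δ : ℝ}
    (hlam : lam ∈ Set.Icc (0:ℝ) 1) (hu : u = p + lam • (q - y))
    (h₁ : ‖P u - (L u + c)‖ ≤ δ) (h₂ : ‖P p - (L p + c)‖ ≤ δ)
    (h₃ : ‖P q - (L q + c)‖ ≤ δ) (h₄ : ‖P y - (L y + c)‖ ≤ δ) (hqy : P q = P y) :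
    ‖P u - P p‖ ≤ 4 * δ := by
  have hLu : L u = L p + lam • (L q - L y) := by rw [hu]; simp
  have key : P u - P p = (P u - (L u + c)) - (P p - (L p + c))
      + lam • ((P y - (L y + c)) - (P q - (L q + c))) := by
    rw [hLu, hqy]; module
  have h₅ := norm_sub_le (P u - (L u + c)) (P p - (L p + c))
  have h₆ := norm_sub_le (P y - (L y + c)) (P q - (L q + c))
  have h₇ : ‖lam • ((P y - (L y + c)) - (P q - (L q + c)))‖ ≤ 2 * δ := by
    rw [norm_smul, Real.norm_of_nonneg hlam.1]
    refine (mul_le_of_le_one_left (norm_nonneg _) hlam.2).trans ?_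
    linarith
  rw [key]
  refine (norm_add_le _ _).trans ?_
  linarith

end

/-- shadows of fixed points of the cyclic relaxed Douglas–Rachford mapping are
almost fixed points of the cyclic projections map, with error `4·Σ ε⁽ⁱ⁾`. -/
theorem stmt9
    {E : Type*} [NormedAddCommGroup E] [InnerProductSpace ℝ E] [FiniteDimensional ℝ E]
    (m : ℕ) (hm : 2 ≤ m)
    (A : ℕ → Set E)
    (hA : ∀ i ∈ Finset.Icc 1 (m+1), (A i).Nonempty ∧ IsClosed (A i))
    (hAper : A (m+1) = A 1)
    (pi : ℕ → E → E) (hpiper : pi (m+1) = pi 1)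
    (hpi : ∀ i ∈ Finset.Icc 1 (m+1), ∀ x : E,
      pi i x ∈ A i ∧ ∀ b ∈ A i, ‖x - pi i x‖ ≤ ‖x - b‖)
    (lam : ℝ) (hlam : lam ∈ Set.Icc (0:ℝ) 1)
    (x : E) (xs : ℕ → E)
    (hxm : xs (m+1) = x)
    (hxs : ∀ i ∈ Finset.Icc 1 m,
      xs i = lam • pi i ((2:ℝ) • pi (i+1) (xs (i+1)) - xs (i+1))
        + (1 - 2*lam) • pi (i+1) (xs (i+1)) + lam • xs (i+1))
    (hfix : xs 1 = x)
    (Uset : ℕ → Set E) (Phi : ℕ → E →ᵃ[ℝ] E) (eps : ℕ → ℝ)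
    (heps : ∀ i ∈ Finset.Icc 1 m, eps i ∈ Set.Ioo (0:ℝ) 1)
    (ha : ∀ i ∈ Finset.Icc 1 m, ∀ w ∈ Uset i, ‖pi i w - Phi i w‖ ≤ eps i)
    (hb : ∀ i ∈ Finset.Icc 1 (m-1), ∀ w ∈ Uset (i+1), pi (i+1) w ∈ Uset i)
    (hc : ∀ i ∈ Finset.Icc 1 m,
      xs i ∈ Uset i ∧
      pi i ((2:ℝ) • pi (i+1) (xs (i+1)) - xs (i+1)) ∈ Uset i ∧
      ((2:ℝ) • pi (i+1) (xs (i+1)) - xs (i+1)) ∈ Uset i ∧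
      pi (i+1) (xs (i+1)) ∈ Uset i)
    (Psi : ℕ → E → E) (epsc : ℕ → ℝ) (M : ℕ → ℝ)
    (hPsi1 : Psi 1 = ⇑(Phi 1)) (hepsc1 : epsc 1 = eps 1)
    (hM : ∀ i ∈ Finset.Icc 1 m, 0 ≤ M i ∧ ∀ w : E, ‖w‖ ≤ 1 → ‖Psi i w‖ ≤ M i)
    (hPsirec : ∀ i ∈ Finset.Icc 1 (m-1), ∀ z : E,
      Psi (i+1) z = (1 - eps (i+1)) • Psi i ((1 / (1 - eps (i+1))) • Phi (i+1) z))
    (hepsrec : ∀ i ∈ Finset.Icc 1 (m-1), epsc (i+1) = epsc i + eps (i+1) * M i) :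
    ‖pi 1 x - ((List.range m).map (fun k => pi (k+1))).foldr (· ∘ ·) id (pi 1 x)‖
      ≤ 4 * ∑ i ∈ Finset.Icc 1 m, epsc i := by
  change ‖pi 1 x - compUpTo pi m (pi 1 x)‖ ≤ _
  have happrox : ∀ i, 1 ≤ i → i ≤ m → ∃ (L : E →ₗ[ℝ] E) (c : E),
      (∀ w, Psi i w = L w + c) ∧
      ∀ w ∈ Uset i, ‖compUpTo pi i w - (L w + c)‖ ≤ epsc i := by
    intro i hi
    induction i, hi using Nat.le_induction with
    | base =>
      intro hm1
      have hdec (w : E) : Phi 1 w = (Phi 1).linear w + Phi 1 0 :=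
        congrFun (AffineMap.decomp (Phi 1)) w
      refine ⟨(Phi 1).linear, Phi 1 0, fun w => by rw [hPsi1, hdec w], fun w hw => ?_⟩
      rw [← hdec, compUpTo_one, hepsc1]
      exact ha 1 (Finset.mem_Icc.2 ⟨le_rfl, hm1⟩) w hw
    | succ i hi ih =>
      intro him
      obtain ⟨L, c, hPsi, hP⟩ := ih (by omega)
      have hi_mem : i ∈ Finset.Icc 1 (m-1) := Finset.mem_Icc.2 ⟨hi, by omega⟩
      have hi_mem' : i + 1 ∈ Finset.Icc 1 m := Finset.mem_Icc.2 ⟨by omega, him⟩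
      have hε := heps (i+1) hi_mem'
      have hε_ne : 1 - eps (i+1) ≠ 0 := by linarith [hε.2]
      have hdec (w : E) : Phi (i+1) w = (Phi (i+1)).linear w + Phi (i+1) 0 :=
        congrFun (AffineMap.decomp (Phi (i+1))) w
      have hform (w : E) : Psi (i+1) w = (L ∘ₗ (Phi (i+1)).linear) w
          + (L (Phi (i+1) 0) + (1 - eps (i+1)) • c) := by
        rw [hPsirec i hi_mem, hPsi, map_smul, smul_add, smul_smul, mul_one_div_cancel hε_ne,
          one_smul, hdec w, map_add, LinearMap.comp_apply, add_assoc]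
      refine ⟨_, _, hform, fun w hw => ?_⟩
      rw [← hform, compUpTo_succ, hPsirec i hi_mem, hPsi, hepsrec i hi_mem]
      have hM' : ∀ v : E, ‖v‖ ≤ 1 → ‖L v + c‖ ≤ M i := fun v hv => by
        rw [← hPsi]
        exact (hM i (Finset.mem_Icc.2 ⟨hi, by omega⟩)).2 v hv
      exact (norm_sub_le_norm_sub_add_norm_sub _ (L (pi (i+1) w) + c) _).trans
        (add_le_add (hP _ (hb i hi_mem w hw))
          (norm_affine_sub_rescaled_le hε hM' (ha (i+1) hi_mem' w hw)))
  have hpi_idem (i : ℕ) (hi : i ∈ Finset.Icc 1 m) (w : E) : pi i (pi i w) = pi i w := by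
    have hi' : i ∈ Finset.Icc 1 (m+1) := by
      rw [Finset.mem_Icc] at hi ⊢; omega
    have h := (hpi i hi' (pi i w)).2 _ (hpi i hi' w).1
    rw [sub_self, norm_zero, norm_le_zero_iff, sub_eq_zero] at h
    exact h.symm
  have hstep (i : ℕ) (hi1 : 1 ≤ i) (him : i ≤ m) :
      ‖compUpTo pi i (xs i) - compUpTo pi i (pi (i+1) (xs (i+1)))‖ ≤ 4 * epsc i := by
    have hi : i ∈ Finset.Icc 1 m := Finset.mem_Icc.2 ⟨hi1, him⟩
    obtain ⟨L, c, -, hP⟩ := happrox i hi1 him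
    obtain ⟨hU₁, hU₂, hU₃, hU₄⟩ := hc i hi
    refine norm_sub_le_of_affine_approx hlam ?_ (hP _ hU₁) (hP _ hU₄) (hP _ hU₂) (hP _ hU₃) ?_
    · rw [hxs i hi]; module
    · obtain ⟨j, rfl⟩ : ∃ j, i = j + 1 := ⟨i - 1, by omega⟩
      rw [compUpTo_succ, compUpTo_succ, hpi_idem _ hi]
  have hsum : ∀ i, 1 ≤ i → i ≤ m →
      ‖pi 1 x - compUpTo pi i (pi (i+1) (xs (i+1)))‖ ≤ 4 * ∑ j ∈ Finset.Icc 1 i, epsc j := by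
    intro i hi
    induction i, hi using Nat.le_induction with
    | base =>
      intro hm1
      have h := hstep 1 le_rfl hm1
      rw [hfix, compUpTo_one] at h
      simpa using h
    | succ i hi ih =>
      intro him
      have h := ih (by omega)
      rw [← compUpTo_succ] at h
      rw [Finset.sum_Icc_succ_top (by omega), mul_add]
      exact (norm_sub_le_norm_sub_add_norm_sub _ _ _).trans
        (add_le_add h (hstep (i+1) (by omega) him))
  have h := hsum m (by omega) le_rfl
  rwa [hxm, hpiper] at h
end
end

section
/- Let E be a finite-dimensional real inner product space, T : E ⇉ E a set-valued mapping, U ⊆ E, y ∈ E, α ∈ (0,1), and ε ≥ 0. The following are equivalent: (i) T is pointwise almost α-firmly nonexpansive at y on U with violation ε, i.e., ‖x⁺ − y⁺‖² ≤ (1 + ε)‖x − y‖² − ((1 − α)/α)·‖(x⁺ − x) − (y⁺ − y)‖² for all x ∈ U, x⁺ ∈ T(x), y⁺ ∈ T(y); (ii) the mapping T̃ := (1 − 1/α)·Id + (1/α)·T (i.e., T̃(z) := {(1 − 1/α)z + (1/α)t : t ∈ T(z)}) is pointwise almost nonexpansive at y on U with violation ε/α, i.e., ‖u − v‖ ≤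 √(1 + ε/α)·‖x − y‖ for all x ∈ U, u ∈ T̃(x), v ∈ T̃(y). Consequently, if (i) holds then T is pointwise almost nonexpansive at y on U with violation at most ε: ‖x⁺ − y⁺‖ ≤ √(1 + ε)·‖x − y‖ for all x ∈ U, x⁺ ∈ T(x), y⁺ ∈ T(y). -/
noncomputable section

lemma le_sqrt_mul_iff_sq_le {a b k : ℝ} (ha : 0 ≤ a) (hb : 0 ≤ b) (hk : 0 ≤ k) :
    a ≤ Real.sqrt k * b ↔ a ^ 2 ≤ k * b ^ 2 := by
  rw [← sq_le_sq₀ ha (by positivity), mul_pow, Real.sq_sqrt hk]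

lemma norm_sq_affine_combination {E : Type*} [NormedAddCommGroup E] [InnerProductSpace ℝ E]
    (c : ℝ) (a b : E) :
    ‖(1 - c) • a + c • b‖ ^ 2
      = (1 - c) * ‖a‖ ^ 2 + c * ‖b‖ ^ 2 - c * (1 - c) * ‖b - a‖ ^ 2 := by
  rw [norm_add_sq_real, norm_sub_sq_real, norm_smul, norm_smul, mul_pow, mul_pow,
    Real.norm_eq_abs, Real.norm_eq_abs, sq_abs, sq_abs, real_inner_smul_left,
    real_inner_smul_right, real_inner_comm a b]
  ring

lemma firmly_nonexpansive_iff_relaxation_nonexpansive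
    {E : Type*} [NormedAddCommGroup E] [InnerProductSpace ℝ E]
    {alpha eps : ℝ} (halpha : 0 < alpha) (heps : 0 ≤ eps) (x y xp yp : E) :
    ‖xp - yp‖ ^ 2 ≤ (1 + eps) * ‖x - y‖ ^ 2
        - ((1 - alpha) / alpha) * ‖(xp - x) - (yp - y)‖ ^ 2 ↔
      ‖((1 - 1 / alpha) • x + (1 / alpha) • xp) - ((1 - 1 / alpha) • y + (1 / alpha) • yp)‖
        ≤ Real.sqrt (1 + eps / alpha) * ‖x - y‖ := by
  have hcomb : ((1 - 1 / alpha) • x + (1 / alpha) • xp)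
      - ((1 - 1 / alpha) • y + (1 / alpha) • yp)
      = (1 - 1 / alpha) • (x - y) + (1 / alpha) • (xp - yp) := by module
  have hdiff : (xp - x) - (yp - y) = (xp - yp) - (x - y) := by abel
  rw [le_sqrt_mul_iff_sq_le (norm_nonneg _) (norm_nonneg _) (by positivity), hcomb, hdiff,
    norm_sq_affine_combination, ← sub_nonneg,
    ← sub_nonneg (b := (1 - 1 / alpha) * ‖x - y‖ ^ 2 + _ - _)]
  rw [← mul_nonneg_iff_of_pos_left (one_div_pos.mpr halpha)]
  refine iff_of_eq (congrArg (0 ≤ ·) ?_)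
  field_simp
  ring

/-- characterization of pointwise almost α-firmly nonexpansive mappings via
pointwise almost nonexpansiveness of `(1 − 1/α)Id + (1/α)T`, and the consequence that
aα-fne mappings are pointwise almost nonexpansive with violation at most ε. -/
theorem stmt12
    {E : Type*} [NormedAddCommGroup E] [InnerProductSpace ℝ E] [FiniteDimensional ℝ E]
    (T : E → Set E) (U : Set E) (y : E)
    (alpha eps : ℝ) (halpha : alpha ∈ Set.Ioo (0:ℝ) 1) (heps : 0 ≤ eps) :
    ((∀ x ∈ U, ∀ xp ∈ T x, ∀ yp ∈ T y,
        ‖xp - yp‖^2 ≤ (1 + eps) * ‖x - y‖^2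
          - ((1 - alpha)/alpha) * ‖(xp - x) - (yp - y)‖^2) ↔
      (∀ x ∈ U,
        ∀ u ∈ {z | ∃ t ∈ T x, z = (1 - 1/alpha) • x + (1/alpha) • t},
        ∀ v ∈ {z | ∃ t ∈ T y, z = (1 - 1/alpha) • y + (1/alpha) • t},
          ‖u - v‖ ≤ Real.sqrt (1 + eps/alpha) * ‖x - y‖))
    ∧ ((∀ x ∈ U, ∀ xp ∈ T x, ∀ yp ∈ T y,
        ‖xp - yp‖^2 ≤ (1 + eps) * ‖x - y‖^2
          - ((1 - alpha)/alpha) * ‖(xp - x) - (yp - y)‖^2) →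
      ∀ x ∈ U, ∀ xp ∈ T x, ∀ yp ∈ T y,
        ‖xp - yp‖ ≤ Real.sqrt (1 + eps) * ‖x - y‖) := by
  obtain ⟨h0, h1⟩ := halpha
  refine ⟨⟨?_, ?_⟩, ?_⟩
  · rintro h x hx _ ⟨xp, hxp, rfl⟩ _ ⟨yp, hyp, rfl⟩
    exact (firmly_nonexpansive_iff_relaxation_nonexpansive h0 heps x y xp yp).1
      (h x hx xp hxp yp hyp)
  · intro h x hx xp hxp yp hyp
    exact (firmly_nonexpansive_iff_relaxation_nonexpansive h0 heps x y xp yp).2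
      (h x hx _ ⟨xp, hxp, rfl⟩ _ ⟨yp, hyp, rfl⟩)
  · intro h x hx xp hxp yp hyp
    rw [le_sqrt_mul_iff_sq_le (norm_nonneg _) (norm_nonneg _) (by positivity)]
    have hnonneg : 0 ≤ ((1 - alpha) / alpha) * ‖(xp - x) - (yp - y)‖ ^ 2 :=
      mul_nonneg (div_nonneg (by linarith) h0.le) (sq_nonneg _)
    linarith [h x hx xp hxp yp hyp]
end
end

section
/- Let E be a finite-dimensional real inner product space and let m ≥ 1. For j = 1,…,m let T_j : E ⇉ E be set-valued mappings, S_j ⊆ U_j ⊆ E, α_j ∈ (0,1), ε_j ≥ 0, and assume each T_j is pointwise almost α_j-firmly nonexpansive at every y ∈ S_j on U_j with violation ε_j (i.e., ‖x⁺ − y⁺‖² ≤ (1 + ε_j)‖x − y‖² − ((1 − α_j)/α_j)‖(x⁺ − x) − (y⁺ − y)‖² for all y ∈ S_j, x ∈ U_j, x⁺ ∈ T_j(x), y⁺ ∈ T_j(y)). Assume T_j(U_j) ⊆ U_{j−1} and T_j(S_j) ⊆ S_{j−1} for j = 2,…,m. Then the composition T := T_1 ∘ T_2 ∘ … ∘ T_m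 is pointwise almost α-firmly nexpansive at every y ∈ S_m on U_m with violation at most ε := Π_{j=1}^m (1 + ε_j) − 1 and constant α := m/(m − 1 + 1/max_{j} α_j); that is, for all y ∈ S_m, x ∈ U_m, x⁺ ∈ T(x), y⁺ ∈ T(y): ‖x⁺ − y⁺‖² ≤ (1 + ε)‖x − y‖² − ((1 − α)/α)‖(x⁺ − x) − (y⁺ − y)‖². -/
noncomputable section

/-- Composition of set-valued mappings: `(S ∘ Q)(x) = ⋃_{y ∈ Q x} S y`. -/
def svComp {E : Type*} (S Q : E → Set E) : E → Set E := fun x => ⋃ y ∈ Q x, S y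

/-- Composition of a list of set-valued mappings (head applied last). -/
def svCompList {E : Type*} (l : List (E → Set E)) : E → Set E :=
  l.foldr svComp (fun x => {x})

theorem mem_svCompList_append_singleton {E : Type*} (l : List (E → Set E)) (Q : E → Set E)
    (x z : E) : z ∈ svCompList (l ++ [Q]) x ↔ ∃ w ∈ Q x, z ∈ svCompList l w := by
  induction l generalizing z with
  | nil => simp [svCompList, svComp]
  | cons R l ih =>
    have key : ∀ (L : List (E → Set E)) (v : E),
        z ∈ svCompList (R :: L) v ↔ ∃ u ∈ svCompList L v, z ∈ R u := by
      intro L v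
      simp [svCompList, svComp]
    rw [List.cons_append, key]
    simp only [key, ih]
    grind

theorem norm_add_sq_le_of_norm_sq_le {E : Type*} [SeminormedAddCommGroup E] {a b : E} {n q : ℝ}
    (hn : 0 ≤ n) (hq : 0 ≤ q) (hb : ‖b‖ ^ 2 ≤ n * q) :
    ‖b + a‖ ^ 2 ≤ (n + 1) * (q + ‖a‖ ^ 2) := by
  have h_cross : 2 * ‖a‖ * ‖b‖ ≤ n * ‖a‖ ^ 2 + q := by
    refine le_of_sq_le_sq ?_ (by positivity)
    nlinarith [mul_le_mul_of_nonneg_left hb (sq_nonneg ‖a‖), sq_nonneg (n * ‖a‖ ^ 2 - q)]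
  have h_tri : ‖b + a‖ ^ 2 ≤ (‖b‖ + ‖a‖) ^ 2 := by
    gcongr
    exact norm_add_le b a
  nlinarith

/-- Chain rule with a common constant `c`; `q` bounds the accumulated squared displacement. -/
theorem exists_norm_sub_sq_le_of_mem_svCompList {E : Type*} [SeminormedAddCommGroup E]
    (T : ℕ → E → Set E) (S U : ℕ → Set E) (eps : ℕ → ℝ) {c : ℝ} (hc : 0 ≤ c) (m : ℕ)
    (heps : ∀ j ∈ Finset.Icc 1 m, 0 ≤ eps j)
    (hfne : ∀ j ∈ Finset.Icc 1 m, ∀ y ∈ S j, ∀ x ∈ U j, ∀ xp ∈ T j x, ∀ yp ∈ T j y,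
      ‖xp - yp‖ ^ 2 ≤ (1 + eps j) * ‖x - y‖ ^ 2 - c * ‖(xp - x) - (yp - y)‖ ^ 2)
    (hU : ∀ j ∈ Finset.Icc 2 m, ∀ u ∈ U j, T j u ⊆ U (j - 1))
    (hS : ∀ j ∈ Finset.Icc 2 m, ∀ u ∈ S j, T j u ⊆ S (j - 1))
    (x y xp yp : E) (hx : 1 ≤ m → x ∈ U m) (hy : 1 ≤ m → y ∈ S m)
    (hxp : xp ∈ svCompList ((List.range m).map (fun k => T (k + 1))) x)
    (hyp : yp ∈ svCompList ((List.range m).map (fun k => T (k + 1))) y) :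
    ∃ q : ℝ, 0 ≤ q ∧ ‖(xp - x) - (yp - y)‖ ^ 2 ≤ m * q ∧
      ‖xp - yp‖ ^ 2 ≤ (∏ j ∈ Finset.Icc 1 m, (1 + eps j)) * ‖x - y‖ ^ 2 - c * q := by
  induction m generalizing x y with
  | zero =>
    simp only [svCompList, List.range_zero, List.map_nil, List.foldr_nil,
      Set.mem_singleton_iff] at hxp hyp
    subst hxp hyp
    exact ⟨0, le_rfl, by simp, by simp⟩
  | succ n ih =>
    rw [List.range_succ, List.map_append, List.map_singleton,
      mem_svCompList_append_singleton] at hxp hyp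
    obtain ⟨u, hu, hxp⟩ := hxp
    obtain ⟨v, hv, hyp⟩ := hyp
    have h_sub : ∀ {a j : ℕ}, j ∈ Finset.Icc a n → j ∈ Finset.Icc a (n + 1) := by
      intro a j hj
      simp only [Finset.mem_Icc] at hj ⊢
      omega
    have h_last : n + 1 ∈ Finset.Icc 1 (n + 1) := by simp
    have hx' := hx (by omega)
    have hy' := hy (by omega)
    obtain ⟨q, hq, hdisp, hle⟩ := ih (fun j hj => heps j (h_sub hj))
      (fun j hj => hfne j (h_sub hj)) (fun j hj => hU j (h_sub hj))
      (fun j hj => hS j (h_sub hj)) u v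
      (fun hn => hU (n + 1) (by simp only [Finset.mem_Icc]; omega) x hx' hu)
      (fun hn => hS (n + 1) (by simp only [Finset.mem_Icc]; omega) y hy' hv) hxp hyp
    have h_step := hfne (n + 1) h_last y hy' x hx' u hu v hv
    have h_prod : 1 ≤ ∏ j ∈ Finset.Icc 1 n, (1 + eps j) :=
      Finset.one_le_prod fun j hj => by linarith [heps j (h_sub hj)]
    refine ⟨q + ‖(u - x) - (v - y)‖ ^ 2, by positivity, ?_, ?_⟩
    · have h := norm_add_sq_le_of_norm_sq_le (a := (u - x) - (v - y)) n.cast_nonneg hq hdisp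
      rw [show (xp - u) - (yp - v) + ((u - x) - (v - y)) = (xp - x) - (yp - y) by abel] at h
      exact_mod_cast h
    · rw [Finset.prod_Icc_succ_top (by omega)]
      have h_mul := mul_le_mul_of_nonneg_left h_step (zero_le_one.trans h_prod)
      have h_disp := mul_le_mul_of_nonneg_right h_prod
        (mul_nonneg hc (sq_nonneg ‖(u - x) - (v - y)‖))
      linarith

/-- chain rule for pointwise almost α-firmly nonexpansive mappings. -/
theorem stmt13
    {E : Type*} [NormedAddCommGroup E] [InnerProductSpace ℝ E] [FiniteDimensional ℝ E]
    (m : ℕ) (hm : 1 ≤ m)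
    (T : ℕ → E → Set E) (S U : ℕ → Set E)
    (alpha eps : ℕ → ℝ)
    (hSU : ∀ j ∈ Finset.Icc 1 m, S j ⊆ U j)
    (halpha : ∀ j ∈ Finset.Icc 1 m, alpha j ∈ Set.Ioo (0:ℝ) 1)
    (heps : ∀ j ∈ Finset.Icc 1 m, 0 ≤ eps j)
    (hfne : ∀ j ∈ Finset.Icc 1 m, ∀ y ∈ S j, ∀ x ∈ U j, ∀ xp ∈ T j x, ∀ yp ∈ T j y,
      ‖xp - yp‖^2 ≤ (1 + eps j) * ‖x - y‖^2
        - ((1 - alpha j)/alpha j) * ‖(xp - x) - (yp - y)‖^2)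
    (hU : ∀ j ∈ Finset.Icc 2 m, ∀ u ∈ U j, T j u ⊆ U (j-1))
    (hS : ∀ j ∈ Finset.Icc 2 m, ∀ u ∈ S j, T j u ⊆ S (j-1)) :
    ∀ y ∈ S m, ∀ x ∈ U m,
      ∀ xp ∈ svCompList ((List.range m).map (fun k => T (k+1))) x,
      ∀ yp ∈ svCompList ((List.range m).map (fun k => T (k+1))) y,
        ‖xp - yp‖^2 ≤ (1 + ((∏ j ∈ Finset.Icc 1 m, (1 + eps j)) - 1)) * ‖x - y‖^2
          - ((1 - (m : ℝ) / ((m : ℝ) - 1 +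
                1 / ((Finset.Icc 1 m).sup' (Finset.nonempty_Icc.mpr hm) alpha))) /
              ((m : ℝ) / ((m : ℝ) - 1 +
                1 / ((Finset.Icc 1 m).sup' (Finset.nonempty_Icc.mpr hm) alpha))))
            * ‖(xp - x) - (yp - y)‖^2 := by
  intro y hy x hx xp hxp yp hyp
  set a := (Finset.Icc 1 m).sup' (Finset.nonempty_Icc.mpr hm) alpha with ha_def
  have ha : a ∈ Set.Ioo (0 : ℝ) 1 := by
    obtain ⟨j, hj, hja⟩ := Finset.exists_mem_eq_sup' (Finset.nonempty_Icc.mpr hm) alpha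
    rw [ha_def, hja]
    exact halpha j hj
  obtain ⟨ha0, ha1⟩ := ha
  have hc : 0 ≤ (1 - a) / a := div_nonneg (by linarith) ha0.le
  have hm0 : (0 : ℝ) < m := by exact_mod_cast hm
  have hfne' : ∀ j ∈ Finset.Icc 1 m, ∀ y ∈ S j, ∀ x ∈ U j, ∀ xp ∈ T j x, ∀ yp ∈ T j y,
      ‖xp - yp‖ ^ 2 ≤ (1 + eps j) * ‖x - y‖ ^ 2
        - ((1 - a) / a) * ‖(xp - x) - (yp - y)‖ ^ 2 := by
    intro j hj y hy x hx xp hxp yp hyp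
    have hja : alpha j ≤ a := Finset.le_sup' alpha hj
    have hj0 := (halpha j hj).1
    have h_const : (1 - a) / a ≤ (1 - alpha j) / alpha j := by
      rw [div_le_div_iff₀ ha0 hj0]
      nlinarith
    have h := hfne j hj y hy x hx xp hxp yp hyp
    have h_mul := mul_le_mul_of_nonneg_right h_const (sq_nonneg ‖(xp - x) - (yp - y)‖)
    linarith
  obtain ⟨q, -, hdisp, hle⟩ := exists_norm_sub_sq_le_of_mem_svCompList T S U eps hc m heps hfne'
    hU hS x y xp yp (fun _ => hx) (fun _ => hy) hxp hyp
  have h_den : 0 < (m : ℝ) - 1 + 1 / a := by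
    have : 1 < 1 / a := by rwa [lt_div_iff₀ ha0, one_mul]
    linarith
  have h_const : (1 - (m : ℝ) / ((m : ℝ) - 1 + 1 / a)) / ((m : ℝ) / ((m : ℝ) - 1 + 1 / a))
      = (1 - a) / a / m := by
    rw [sub_div, div_self (by positivity), one_div_div]
    field_simp
    ring
  have h_disp : (1 - a) / a / m * ‖(xp - x) - (yp - y)‖ ^ 2 ≤ (1 - a) / a * q := by
    rw [div_mul_eq_mul_div, div_le_iff₀ hm0]
    nlinarith [mul_le_mul_of_nonneg_left hdisp hc]
  rw [h_const]
  linarith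
end
end

section
/- Let E be a finite-dimensional real inner product space, Ω ⊆ E nonempty and closed, x̄ ∈ Ω, U an open neighborhood of x̄, and Λ := {y' ∈ U : x̄ ∈ P_Ω(y')} (= P_Ω⁻¹(x̄) ∩ U). Suppose Ω is ε-super-regular at a distance relative to Λ at x̄ with constant ε_U ∈ [0,1) on U; that is, for all y' ∈ U ∩ Λ, all y ∈ P_Ω(y'), and all pairs (x, v) ∈ E × E with x + v ∈ U and x ∈ P_Ω(x + v): ⟨v − (y' − y), y − x⟩ ≤ ε_U·‖v − (y' − y)‖·‖y − x‖. Then for all y ∈ Λ, x ∈ U, x⁺ ∈ P_Ω(x), y⁺ ∈ P_Ω(y): (a) ‖x⁺ − y⁺‖ ≤ √(1 + ε̂)·‖x − y‖ with ε̂ := 4ε_U/(1 − ε_U)²; and (b) ‖x⁺ − y⁺‖² + ‖(x⁺ − x) − (y⁺ − y)‖² ≤ (1 + ε̌)·‖x − y‖² with ε̌ := 4ε_U(1 + ε_U)/(1 − ε_U)². In other words, the projector P_Ω is pointwise almost nonexpansive on U at each y ∈ Λ with violation ε̂, and pointwise almost firmly nonexpansive (constant α = 1/2) at each y ∈ Λ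 with violation ε̌. -/
noncomputable section

open scoped RealInnerProductSpace

/-- If the angle between `d` and `w` is almost acute, then `d` and `w` are controlled by `d + w`. -/
lemma norm_sq_bounds_of_neg_inner_le {E : Type*} [NormedAddCommGroup E] [InnerProductSpace ℝ E]
    {d w : E} {ε : ℝ} (h0 : 0 ≤ ε) (h : -⟪d, w⟫ ≤ ε * ‖w‖ * ‖d‖) :
    (1 - ε ^ 2) * ‖d‖ ^ 2 ≤ ‖d + w‖ ^ 2 ∧
      (1 - ε) * (‖d‖ ^ 2 + ‖w‖ ^ 2) ≤ ‖d + w‖ ^ 2 := by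
  rw [norm_add_sq_real]
  constructor
  · nlinarith [sq_nonneg (‖w‖ - ε * ‖d‖)]
  · nlinarith [mul_nonneg h0 (sq_nonneg (‖w‖ - ‖d‖))]

/-- projectors of ε-super-regular (at a distance) sets are pointwise almost
nonexpansive with violation `ε̂ = 4ε_U/(1−ε_U)²` and pointwise almost firmly nonexpansive
with violation `ε̌ = 4ε_U(1+ε_U)/(1−ε_U)²`. -/
theorem stmt14
    {E : Type*} [NormedAddCommGroup E] [InnerProductSpace ℝ E] [FiniteDimensional ℝ E]
    (Omega : Set E) (hne : Omega.Nonempty) (hcl : IsClosed Omega)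
    (xbar : E) (hxbar : xbar ∈ Omega)
    (U : Set E) (hUopen : IsOpen U) (hxU : xbar ∈ U)
    (epsU : ℝ) (hepsU : epsU ∈ Set.Ico (0:ℝ) 1)
    (hsr : ∀ y' ∈ U ∩ {w ∈ U | xbar ∈ projSet Omega w}, ∀ y ∈ projSet Omega y',
      ∀ x v : E, x + v ∈ U → x ∈ projSet Omega (x + v) →
        ⟪v - (y' - y), y - x⟫ ≤ epsU * ‖v - (y' - y)‖ * ‖y - x‖) :
    ∀ y ∈ {w ∈ U | xbar ∈ projSet Omega w}, ∀ x ∈ U,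
      ∀ xp ∈ projSet Omega x, ∀ yp ∈ projSet Omega y,
        (‖xp - yp‖ ≤ Real.sqrt (1 + 4*epsU/(1-epsU)^2) * ‖x - y‖)
        ∧ (‖xp - yp‖^2 + ‖(xp - x) - (yp - y)‖^2
            ≤ (1 + 4*epsU*(1+epsU)/(1-epsU)^2) * ‖x - y‖^2) := by
  rintro y hy x hx xp hxp yp hyp
  obtain ⟨h0, h1⟩ := hepsU
  have hpos : 0 < 1 - epsU := by linarith
  have h := hsr y ⟨hy.1, hy⟩ yp hyp xp (x - xp) (by simpa using hx) (by simpa using hxp)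
  rw [← neg_sub xp yp, inner_neg_right, norm_neg, real_inner_comm] at h
  obtain ⟨hd, hdw⟩ := norm_sq_bounds_of_neg_inner_le h0 h
  have hsum : xp - yp + (x - xp - (y - yp)) = x - y := by abel
  have hneg : ‖(xp - x) - (yp - y)‖ = ‖x - xp - (y - yp)‖ := by
    rw [← norm_neg]; congr 1; abel
  rw [hsum] at hd hdw
  rw [hneg]
  constructor
  · refine abs_le_of_sq_le_sq' ?_ (by positivity) |>.2
    rw [mul_pow, Real.sq_sqrt (by positivity)]
    have hc : 1 ≤ (1 + 4 * epsU / (1 - epsU) ^ 2) * (1 - epsU ^ 2) := by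
      have : (1 + 4 * epsU / (1 - epsU) ^ 2) * (1 - epsU ^ 2)
          = (1 + epsU) ^ 3 / (1 - epsU) := by
        field_simp; ring
      rw [this, le_div_iff₀ hpos]
      nlinarith [pow_nonneg h0 2, pow_nonneg h0 3]
    calc ‖xp - yp‖ ^ 2
        ≤ (1 + 4 * epsU / (1 - epsU) ^ 2) * (1 - epsU ^ 2) * ‖xp - yp‖ ^ 2 :=
          le_mul_of_one_le_left (by positivity) hc
      _ ≤ _ := by rw [mul_assoc]; gcongr
  · have hc : 1 ≤ (1 + 4 * epsU * (1 + epsU) / (1 - epsU) ^ 2) * (1 - epsU) := by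
      have : (1 + 4 * epsU * (1 + epsU) / (1 - epsU) ^ 2) * (1 - epsU)
          = (1 + 2 * epsU + 5 * epsU ^ 2) / (1 - epsU) := by
        field_simp; ring
      rw [this, le_div_iff₀ hpos]
      nlinarith [pow_nonneg h0 2]
    calc ‖xp - yp‖ ^ 2 + ‖x - xp - (y - yp)‖ ^ 2
        ≤ (1 + 4 * epsU * (1 + epsU) / (1 - epsU) ^ 2) * (1 - epsU)
            * (‖xp - yp‖ ^ 2 + ‖x - xp - (y - yp)‖ ^ 2) :=
          le_mul_of_one_le_left (by positivity) hc
      _ ≤ _ := by rw [mul_assoc]; gcongr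
end
end

section
/- Let E be a finite-dimensional real inner product space, Ω ⊆ E nonempty and closed, x̄ ∈ Ω, U an open neighborhood of x̄, and Λ := {y' ∈ U : x̄ ∈ P_Ω(y')} (= P_Ω⁻¹(x̄) ∩ U). Suppose Ω is ε-super-regular at a distance relative to Λ at x̄ with constant ε_U ∈ [0,1) on U; that is, for all y' ∈ U ∩ Λ, all y ∈ P_Ω(y'), and all pairs (x, v) ∈ E × E with x + v ∈ U and x ∈ P_Ω(x + v): ⟨v − (y' − y), y − x⟩ ≤ ε_U·‖v − (y' − y)‖·‖y − x‖. Then the reflector R_Ω := 2P_Ω − Id satisfies: for all y ∈ Λ, x ∈ U, x⁺ ∈ R_Ω(x), y⁺ ∈ R_Ω(y), ‖x⁺ − y⁺‖ ≤ √(1 + ε̃)·‖x − y‖, where ε̃ := 8ε_U(1 + ε_U)/(1 − ε_U)². In other words, R_Ω is pointwise almost nonexpansive at each y ∈ Λ on U with violation ε̃. -/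
noncomputable section

open scoped RealInnerProductSpace

/-- The (possibly set-valued) reflector across `A`: `R_A = 2P_A − Id`. -/
def reflSet {E : Type*} [NormedAddCommGroup E] [InnerProductSpace ℝ E]
    (A : Set E) (x : E) : Set E :=
  {z | ∃ a ∈ projSet A x, z = (2:ℝ) • a - x}

/-- If the angle between `p` and `q` is bounded away from `π`, then `‖p - q‖` is controlled
by `‖p + q‖`. -/
theorem norm_sub_le_sqrt_mul_norm_add {E : Type*} [NormedAddCommGroup E]
    [InnerProductSpace ℝ E] {p q : E} {ε : ℝ} (h0 : 0 ≤ ε) (h1 : ε < 1)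
    (h : -⟪p, q⟫ ≤ ε * (‖p‖ * ‖q‖)) :
    ‖p - q‖ ≤ Real.sqrt (1 + 8*ε*(1+ε)/(1-ε)^2) * ‖p + q‖ := by
  have hpos : 0 < 1 - ε := sub_pos.2 h1
  have hadd := norm_add_sq_real p q
  have hsub := norm_sub_sq_real p q
  have hprod : 2 * (1 - ε) * (‖p‖ * ‖q‖) ≤ ‖p + q‖ ^ 2 := by
    nlinarith [sq_nonneg (‖p‖ - ‖q‖)]
  have hbound : 4 * ε * (‖p‖ * ‖q‖) ≤ 8*ε*(1+ε)/(1-ε)^2 * ‖p + q‖ ^ 2 := by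
    rw [div_mul_eq_mul_div, le_div_iff₀ (pow_pos hpos 2)]
    calc 4 * ε * (‖p‖ * ‖q‖) * (1 - ε) ^ 2
        = 2 * ε * (1 - ε) * (2 * (1 - ε) * (‖p‖ * ‖q‖)) := by ring
      _ ≤ 2 * ε * (1 - ε) * ‖p + q‖ ^ 2 := by gcongr
      _ ≤ 8 * ε * (1 + ε) * ‖p + q‖ ^ 2 := by
        apply mul_le_mul_of_nonneg_right _ (sq_nonneg _)
        nlinarith
  rw [← Real.sqrt_sq (norm_nonneg (p + q)), ← Real.sqrt_mul (by positivity)]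
  apply Real.le_sqrt_of_sq_le
  linarith

/-- reflectors of ε-super-regular (at a distance) sets are pointwise almost
nonexpansive with violation `ε̃ = 8ε_U(1+ε_U)/(1−ε_U)²`. -/
theorem stmt15
    {E : Type*} [NormedAddCommGroup E] [InnerProductSpace ℝ E] [FiniteDimensional ℝ E]
    (Omega : Set E) (hne : Omega.Nonempty) (hcl : IsClosed Omega)
    (xbar : E) (hxbar : xbar ∈ Omega)
    (U : Set E) (hUopen : IsOpen U) (hxU : xbar ∈ U)
    (epsU : ℝ) (hepsU : epsU ∈ Set.Ico (0:ℝ) 1)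
    (hsr : ∀ y' ∈ U ∩ {w ∈ U | xbar ∈ projSet Omega w}, ∀ y ∈ projSet Omega y',
      ∀ x v : E, x + v ∈ U → x ∈ projSet Omega (x + v) →
        ⟪v - (y' - y), y - x⟫ ≤ epsU * ‖v - (y' - y)‖ * ‖y - x‖) :
    ∀ y ∈ {w ∈ U | xbar ∈ projSet Omega w}, ∀ x ∈ U,
      ∀ xp ∈ reflSet Omega x, ∀ yp ∈ reflSet Omega y,
        ‖xp - yp‖ ≤ Real.sqrt (1 + 8*epsU*(1+epsU)/(1-epsU)^2) * ‖x - y‖ := by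
  rintro y hy x hx xp ⟨a, ha, rfl⟩ yp ⟨b, hb, rfl⟩
  obtain ⟨h0, h1⟩ := hepsU
  have hreg := hsr y ⟨hy.1, hy⟩ b hb a (x - a) (by simpa using hx) (by simpa using ha)
  have hinner : -⟪a - b, (x - a) - (y - b)⟫ ≤
      epsU * (‖a - b‖ * ‖(x - a) - (y - b)‖) := by
    rw [← inner_neg_left, neg_sub, real_inner_comm, mul_comm ‖a - b‖, ← mul_assoc,
      norm_sub_rev a b]
    exact hreg
  rw [show x - y = (a - b) + ((x - a) - (y - b)) by abel,
    show (2:ℝ) • a - x - ((2:ℝ) • b - y) = (a - b) - ((x - a) - (y - b)) by module]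
  exact norm_sub_le_sqrt_mul_norm_add h0 h1 hinner
end
end

section
/- Let E be a finite-dimensional real inner product space, let A and B be nonempty closed subsets of E, let λ ∈ [0,1], and let Λ_A ⊆ U_A ⊆ E and Λ_B ⊆ U_B ⊆ E. Assume: (a) the reflector R_A is pointwise almost nonexpansive at every point of Λ_A on U_A with violation ε̃_A ≥ 0, i.e., ‖z' − u'‖ ≤ √(1 + ε̃_A)‖z − u‖ for all u ∈ Λ_A, u' ∈ R_A(u), z ∈ U_A, z' ∈ R_A(z); (b) likewise R_B is pointwise almost nonexpansive at every point of Λ_B on U_B with violation ε̃_B ≥ 0; (c) R_B(U_B) ⊆ U_A and R_B(Λ_B) ⊆ Λ_A. Then the relaxed Douglas–Rachford operator T := (λ/2)(R_A R_B + Id) + (1 − λ)P_B, defined set-valuedly by T(x) := {(λ/2)(w + x) + (1 − λ)p : p ∈ P_B(x), w ∈ R_A(2p − x)}, is pointwise almost firmly nonexpansive (constant α = 1/2) at every y ∈ Λ_B on U_B with violation ε := (1/2)[(λ√(1 + ε̃_A) + 1 − λ)²·(1 + ε̃_B) − 1]; that is, for all y ∈ Λ_B, x ∈ U_B, x⁺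 ∈ T(x), y⁺ ∈ T(y): ‖x⁺ − y⁺‖² ≤ (1 + ε)‖x − y‖² − ‖(x⁺ − x) − (y⁺ − y)‖². -/
noncomputable section

/-- The parallelogram law for `a` and `a - d`, solved for the sum of squares. -/
theorem norm_sq_add_norm_sub_sq {E : Type*} [NormedAddCommGroup E] [InnerProductSpace ℝ E]
    (a d : E) :
    ‖a‖ ^ 2 + ‖a - d‖ ^ 2 = (1 / 2) * (‖(2:ℝ) • a - d‖ ^ 2 + ‖d‖ ^ 2) := by
  have h := parallelogram_law_with_norm ℝ a (a - d)
  have h₁ : a + (a - d) = (2:ℝ) • a - d := by module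
  rw [h₁, sub_sub_cancel] at h
  linarith

/-- the two-set relaxed Douglas–Rachford operator built from pointwise almost
nonexpansive reflectors is pointwise almost firmly nonexpansive (constant 1/2) with violation
`ε = (1/2)[(λ√(1+ε̃_A) + 1 − λ)²(1+ε̃_B) − 1]`. -/
theorem stmt16
    {E : Type*} [NormedAddCommGroup E] [InnerProductSpace ℝ E] [FiniteDimensional ℝ E]
    (A B : Set E) (hAne : A.Nonempty) (hAcl : IsClosed A)
    (hBne : B.Nonempty) (hBcl : IsClosed B)
    (lam : ℝ) (hlam : lam ∈ Set.Icc (0:ℝ) 1)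
    (LamA UA LamB UB : Set E) (hLA : LamA ⊆ UA) (hLB : LamB ⊆ UB)
    (eA eB : ℝ) (heA : 0 ≤ eA) (heB : 0 ≤ eB)
    (hRA : ∀ u ∈ LamA, ∀ u' ∈ reflSet A u, ∀ z ∈ UA, ∀ z' ∈ reflSet A z,
      ‖z' - u'‖ ≤ Real.sqrt (1 + eA) * ‖z - u‖)
    (hRB : ∀ u ∈ LamB, ∀ u' ∈ reflSet B u, ∀ z ∈ UB, ∀ z' ∈ reflSet B z,
      ‖z' - u'‖ ≤ Real.sqrt (1 + eB) * ‖z - u‖)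
    (hUsub : ∀ z ∈ UB, reflSet B z ⊆ UA)
    (hLsub : ∀ z ∈ LamB, reflSet B z ⊆ LamA) :
    ∀ y ∈ LamB, ∀ x ∈ UB,
      ∀ xp ∈ {z | ∃ p ∈ projSet B x, ∃ w ∈ reflSet A ((2:ℝ) • p - x),
          z = (lam/2) • (w + x) + (1 - lam) • p},
      ∀ yp ∈ {z | ∃ p ∈ projSet B y, ∃ w ∈ reflSet A ((2:ℝ) • p - y),
          z = (lam/2) • (w + y) + (1 - lam) • p},
        ‖xp - yp‖^2
          ≤ (1 + (1/2) * ((lam * Real.sqrt (1 + eA) + 1 - lam)^2 * (1 + eB) - 1)) * ‖x - y‖^2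
            - ‖(xp - x) - (yp - y)‖^2 := by
  rintro y hy x hx xp ⟨p, hp, w, hw, rfl⟩ yp ⟨q, hq, v, hv, rfl⟩
  obtain ⟨hlam₀, hlam₁⟩ := hlam
  have hr : (2:ℝ) • p - x ∈ reflSet B x := ⟨p, hp, rfl⟩
  have hs : (2:ℝ) • q - y ∈ reflSet B y := ⟨q, hq, rfl⟩
  have hB := hRB y hy _ hs x hx _ hr
  have hA := hRA _ (hLsub y hy hs) v hv _ (hUsub x hx hr) w hw
  set r := (2:ℝ) • p - x with hr_def
  set s := (2:ℝ) • q - y with hs_def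
  have hN : ‖lam • (w - v) + (1 - lam) • (r - s)‖
      ≤ (lam * √(1 + eA) + 1 - lam) * (√(1 + eB) * ‖x - y‖) := by
    calc ‖lam • (w - v) + (1 - lam) • (r - s)‖
        ≤ ‖lam • (w - v)‖ + ‖(1 - lam) • (r - s)‖ := norm_add_le _ _
      _ = lam * ‖w - v‖ + (1 - lam) * ‖r - s‖ := by
          rw [norm_smul_of_nonneg hlam₀, norm_smul_of_nonneg (sub_nonneg.2 hlam₁)]
      _ ≤ lam * (√(1 + eA) * ‖r - s‖) + (1 - lam) * ‖r - s‖ := by gcongr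
      _ = (lam * √(1 + eA) + (1 - lam)) * ‖r - s‖ := by ring
      _ ≤ (lam * √(1 + eA) + (1 - lam)) * (√(1 + eB) * ‖x - y‖) := by
          have := sub_nonneg.2 hlam₁
          gcongr
      _ = _ := by ring
  have hN_sq : ‖lam • (w - v) + (1 - lam) • (r - s)‖ ^ 2
      ≤ (lam * √(1 + eA) + 1 - lam) ^ 2 * (1 + eB) * ‖x - y‖ ^ 2 := by
    refine (pow_le_pow_left₀ (norm_nonneg _) hN 2).trans_eq ?_
    rw [mul_pow, mul_pow, Real.sq_sqrt (by positivity)]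
    ring
  set a := ((lam / 2) • (w + x) + (1 - lam) • p) - ((lam / 2) • (v + y) + (1 - lam) • q)
    with ha_def
  have hdouble : (2:ℝ) • a - (x - y) = lam • (w - v) + (1 - lam) • (r - s) := by
    rw [ha_def, hr_def, hs_def]
    module
  have hpar := norm_sq_add_norm_sub_sq a (x - y)
  rw [hdouble] at hpar
  rw [sub_sub_sub_comm _ x _ y, ← ha_def]
  linarith
end
end

section
/- Let E be a finite-dimensional real inner product space, T : E ⇉ E a set-valued mapping, Λ, U ⊆ E, α ∈ (0,1), ε ≥ 0, and κ > 0 with (1 − α)/(α·κ²) ≤ 1 + ε. Let S := Fix T ∩ Λ, where Fix T := {x : x ∈ T(x)}, and assume S is nonempty and closed. Assume: (a) T is pointwise almost α-firmly nonexpansive at every y ∈ S on U with violation ε, i.e., ‖x⁺ − y⁺‖² ≤ (1 + ε)‖x − y‖² − ((1 − α)/α)‖(x⁺ − x) − (y⁺ − y)‖² for all y ∈ S, x ∈ U, x⁺ ∈ T(x), y⁺ ∈ T(y); and (b) metric subregularity with linear gauge: dist(x, S) ≤ κ·dist(x, T(x)) for all x ∈ U ∩ Λ, where dist(x, T(x))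 := inf_{t ∈ T(x)} ‖x − t‖. Then for every x ∈ U ∩ Λ and every x⁺ ∈ T(x), dist(x⁺, S) ≤ c·dist(x, S), where c := √(1 + ε − (1 − α)/(κ²·α)). -/
noncomputable section

/-- one-step linear contraction estimate for a pointwise almost α-firmly
nonexpansive mapping that is metrically subregular with a linear gauge. -/
theorem stmt18
    {E : Type*} [NormedAddCommGroup E] [InnerProductSpace ℝ E] [FiniteDimensional ℝ E]
    (T : E → Set E) (Lam U : Set E)
    (alpha eps kappa : ℝ)
    (halpha : alpha ∈ Set.Ioo (0:ℝ) 1) (heps : 0 ≤ eps) (hkappa : 0 < kappa)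
    (hcomp : (1 - alpha) / (alpha * kappa^2) ≤ 1 + eps)
    (hSne : ({w : E | w ∈ T w} ∩ Lam).Nonempty)
    (hScl : IsClosed ({w : E | w ∈ T w} ∩ Lam))
    (hfne : ∀ y ∈ {w : E | w ∈ T w} ∩ Lam, ∀ x ∈ U, ∀ xp ∈ T x, ∀ yp ∈ T y,
      ‖xp - yp‖^2 ≤ (1 + eps) * ‖x - y‖^2
        - ((1 - alpha)/alpha) * ‖(xp - x) - (yp - y)‖^2)
    (hmsr : ∀ x ∈ U ∩ Lam,
      Metric.infDist x ({w : E | w ∈ T w} ∩ Lam) ≤ kappa * Metric.infDist x (T x)) :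
    ∀ x ∈ U ∩ Lam, ∀ xp ∈ T x,
      Metric.infDist xp ({w : E | w ∈ T w} ∩ Lam)
        ≤ Real.sqrt (1 + eps - (1 - alpha) / (kappa^2 * alpha))
          * Metric.infDist x ({w : E | w ∈ T w} ∩ Lam) := by
  obtain ⟨ha0, ha1⟩ := halpha
  intro x hx xp hxp
  obtain ⟨y, hyS, hxy⟩ := hScl.exists_infDist_eq_dist hSne x
  have hstep := hfne y hyS x hx.1 xp hxp y hyS.1
  have hreg := hmsr x hx
  have hres : Metric.infDist x (T x) ≤ ‖xp - x‖ := by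
    simpa only [dist_eq_norm_sub'] using Metric.infDist_le_dist_of_mem (x := x) hxp
  have hxp_le : Metric.infDist xp ({w : E | w ∈ T w} ∩ Lam) ≤ ‖xp - y‖ := by
    simpa only [dist_eq_norm] using Metric.infDist_le_dist_of_mem (x := xp) hyS
  have hd0 : 0 ≤ Metric.infDist x ({w : E | w ∈ T w} ∩ Lam) := Metric.infDist_nonneg
  rw [sub_self, sub_zero, ← dist_eq_norm x y, ← hxy] at hstep
  set d := Metric.infDist x ({w : E | w ∈ T w} ∩ Lam)
  have hdr : d ^ 2 ≤ kappa ^ 2 * ‖xp - x‖ ^ 2 := by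
    rw [← mul_pow]
    exact pow_le_pow_left₀ hd0 (hreg.trans (by gcongr)) 2
  have hgain : (1 - alpha) / (kappa ^ 2 * alpha) * d ^ 2
      ≤ (1 - alpha) / alpha * ‖xp - x‖ ^ 2 := by
    have h1 : 0 ≤ 1 - alpha := by linarith
    calc (1 - alpha) / (kappa ^ 2 * alpha) * d ^ 2
        ≤ (1 - alpha) / (kappa ^ 2 * alpha) * (kappa ^ 2 * ‖xp - x‖ ^ 2) := by gcongr
      _ = (1 - alpha) / alpha * ‖xp - x‖ ^ 2 := by field_simp
  have hc : 0 ≤ 1 + eps - (1 - alpha) / (kappa ^ 2 * alpha) := by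
    rw [mul_comm (kappa ^ 2)]
    linarith
  refine hxp_le.trans (abs_le_of_sq_le_sq' ?_ (by positivity)).2
  rw [mul_pow, Real.sq_sqrt hc]
  linarith
end
end

section
/- Let E be a finite-dimensional real inner product space, let m ≥ 2, let A_1,…,A_m be nonempty closed subsets of E with A_{m+1} := A_1, and let Λ_i ⊆ U_i ⊆ E for i = 1,…,m+1 (Λ_{m+1}, U_{m+1} corresponding to A_{m+1}). Assume: (a) for each i, the projector P_{A_i} is pointwise almost nonexpansive at every point of Λ_i on U_i with violation ε̂_i ≥ 0, i.e., ‖v' − u'‖ ≤ √(1 + ε̂_i)‖v − u‖ for all u ∈ Λ_i, u' ∈ P_{A_i}(u), v ∈ U_i, v' ∈ P_{A_i}(v); (b) P_{A_{i+1}}(Λ_{i+1}) ⊆ Λ_i and P_{A_{i+1}}(U_{i+1}) ⊆ U_i for i = 1,…,m. Let (y^{(k)})_{k≥0} ⊆ Λ_{m+1} be a sequence converging to a point y* ∈ Λ_{m+1}. For each k choose y^{(m+1,k)} ∈ P_{A_{m+1}}(y^{(k)}) and, for i = m down to 1, y^{(i,k)} ∈ P_{A_i}(y^{(i+1,k)});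 similarly choose y^{(m+1,*)} ∈ P_{A_{m+1}}(y*) and y^{(i,*)} ∈ P_{A_i}(y^{(i+1,*)}). Define gap^{(k)} := Σ_{i=1}^m ‖y^{(i+1,k)} − y^{(i,k)}‖. Then: (1) for each i, y^{(i,k)} → y^{(i,*)} as k → ∞, and consequently gap^{(k)} converges to the constant g := Σ_{i=1}^m ‖y^{(i+1,*)} − y^{(i,*)}‖ ≥ 0; (2) if g = 0, then ⋂_{i=1}^m A_i ≠ ∅ (indeed y^{(1,*)} = … = y^{(m+1,*)} is a common point). -/
noncomputable section

/-- A projector that is pointwise almost nonexpansive at the limit point carries convergent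
sequences to convergent sequences. -/
theorem tendsto_of_mem_projSet {E : Type*} [NormedAddCommGroup E] {A V : Set E} {c : ℝ}
    {x x' : ℕ → E} {u u' : E}
    (hne : ∀ v ∈ V, ∀ v' ∈ projSet A v, ‖v' - u'‖ ≤ c * ‖v - u‖)
    (hx : ∀ k, x k ∈ V) (hx' : ∀ k, x' k ∈ projSet A (x k))
    (hlim : Filter.Tendsto x Filter.atTop (nhds u)) :
    Filter.Tendsto x' Filter.atTop (nhds u') := by
  rw [tendsto_iff_norm_sub_tendsto_zero] at hlim ⊢
  refine squeeze_zero (fun k => norm_nonneg _) (fun k => hne _ (hx k) _ (hx' k)) ?_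
  simpa using hlim.const_mul c

/-- A descending chain whose total gap vanishes is constant. -/
theorem eq_of_sum_norm_sub_eq_zero {E : Type*} [NormedAddCommGroup E] {m : ℕ} {z : ℕ → E}
    (h : ∑ i ∈ Finset.Icc 1 m, ‖z (i + 1) - z i‖ = 0) :
    ∀ i ∈ Finset.Icc 1 m, z i = z 1 := by
  rw [Finset.sum_eq_zero_iff_of_nonneg fun _ _ => norm_nonneg _] at h
  intro i hi
  obtain ⟨h1, hm⟩ := Finset.mem_Icc.mp hi
  clear hi
  induction i, h1 using Nat.le_induction with
  | base => rfl
  | succ n hn ih =>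
    have hstep := h n (Finset.mem_Icc.mpr ⟨hn, by omega⟩)
    rw [norm_sub_eq_zero_iff] at hstep
    rw [hstep, ih (by omega)]

/-- convergence of the gap along the projection chains, and consistency of the
feasibility problem when the limiting gap is zero. -/
theorem stmt19
    {E : Type*} [NormedAddCommGroup E] [InnerProductSpace ℝ E] [FiniteDimensional ℝ E]
    (m : ℕ) (hm : 2 ≤ m)
    (A : ℕ → Set E)
    (hA : ∀ i ∈ Finset.Icc 1 (m+1), (A i).Nonempty ∧ IsClosed (A i))
    (hAper : A (m+1) = A 1)
    (Lam U : ℕ → Set E)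
    (hLU : ∀ i ∈ Finset.Icc 1 (m+1), Lam i ⊆ U i)
    (ehat : ℕ → ℝ) (hehat : ∀ i ∈ Finset.Icc 1 (m+1), 0 ≤ ehat i)
    (hne : ∀ i ∈ Finset.Icc 1 (m+1), ∀ u ∈ Lam i, ∀ u' ∈ projSet (A i) u,
      ∀ v ∈ U i, ∀ v' ∈ projSet (A i) v,
        ‖v' - u'‖ ≤ Real.sqrt (1 + ehat i) * ‖v - u‖)
    (hsub : ∀ i ∈ Finset.Icc 1 m,
      (∀ u ∈ Lam (i+1), projSet (A (i+1)) u ⊆ Lam i) ∧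
      (∀ u ∈ U (i+1), projSet (A (i+1)) u ⊆ U i))
    (y : ℕ → E) (ystar : E)
    (hy : ∀ k, y k ∈ Lam (m+1)) (hystar : ystar ∈ Lam (m+1))
    (hconv : Filter.Tendsto y Filter.atTop (nhds ystar))
    (Y : ℕ → ℕ → E) (Ys : ℕ → E)
    (hY : ∀ k, Y k (m+1) ∈ projSet (A (m+1)) (y k))
    (hYc : ∀ k, ∀ i ∈ Finset.Icc 1 m, Y k i ∈ projSet (A i) (Y k (i+1)))
    (hYs : Ys (m+1) ∈ projSet (A (m+1)) ystar)
    (hYsc : ∀ i ∈ Finset.Icc 1 m, Ys i ∈ projSet (A i) (Ys (i+1))) :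
    (∀ i ∈ Finset.Icc 1 (m+1),
      Filter.Tendsto (fun k => Y k i) Filter.atTop (nhds (Ys i)))
    ∧ Filter.Tendsto (fun k => ∑ i ∈ Finset.Icc 1 m, ‖Y k (i+1) - Y k i‖)
        Filter.atTop (nhds (∑ i ∈ Finset.Icc 1 m, ‖Ys (i+1) - Ys i‖))
    ∧ (0 ≤ ∑ i ∈ Finset.Icc 1 m, ‖Ys (i+1) - Ys i‖)
    ∧ ((∑ i ∈ Finset.Icc 1 m, ‖Ys (i+1) - Ys i‖) = 0 →
        (⋂ i ∈ Finset.Icc 1 m, A i).Nonempty) := by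
  have hchain : ∀ j i, i + j = m → 1 ≤ i →
      (∀ k, Y k (i + 1) ∈ Lam i) ∧ Ys (i + 1) ∈ Lam i ∧
        Filter.Tendsto (fun k => Y k (i + 1)) Filter.atTop (nhds (Ys (i + 1))) := by
    intro j
    induction j with
    | zero =>
      rintro i rfl hi
      have hmem := (hsub i (Finset.mem_Icc.mpr ⟨hi, le_rfl⟩)).1
      have hi' : i + 1 ∈ Finset.Icc 1 (i + 1) := Finset.mem_Icc.mpr ⟨by omega, le_rfl⟩
      exact ⟨fun k => hmem _ (hy k) (hY k), hmem _ hystar hYs,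
        tendsto_of_mem_projSet (hne _ hi' _ hystar _ hYs) (fun k => hLU _ hi' (hy k)) hY hconv⟩
    | succ j ih =>
      intro i hij hi
      obtain ⟨hYmem, hYsmem, hlim⟩ := ih (i + 1) (by omega) (by omega)
      have hmem := (hsub i (Finset.mem_Icc.mpr ⟨hi, by omega⟩)).1
      have hi₁ : i + 1 ∈ Finset.Icc 1 m := Finset.mem_Icc.mpr ⟨by omega, by omega⟩
      have hi₂ : i + 1 ∈ Finset.Icc 1 (m + 1) := Finset.mem_Icc.mpr ⟨by omega, by omega⟩
      exact ⟨fun k => hmem _ (hYmem k) (hYc k _ hi₁), hmem _ hYsmem (hYsc _ hi₁),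
        tendsto_of_mem_projSet (hne _ hi₂ _ hYsmem _ (hYsc _ hi₁))
          (fun k => hLU _ hi₂ (hYmem k)) (fun k => hYc k _ hi₁) hlim⟩
  have htend : ∀ i ∈ Finset.Icc 1 (m + 1),
      Filter.Tendsto (fun k => Y k i) Filter.atTop (nhds (Ys i)) := by
    intro i hi
    obtain ⟨h1, hi_le⟩ := Finset.mem_Icc.mp hi
    obtain rfl | ⟨n, hn, rfl⟩ : i = 1 ∨ ∃ n, 1 ≤ n ∧ i = n + 1 := by
      rcases h1.eq_or_lt with h | h
      · exact Or.inl h.symm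
      · exact Or.inr ⟨i - 1, by omega, by omega⟩
    · obtain ⟨hYmem, hYsmem, hlim⟩ := hchain (m - 1) 1 (by omega) le_rfl
      have h1m : 1 ∈ Finset.Icc 1 m := Finset.mem_Icc.mpr ⟨le_rfl, by omega⟩
      exact tendsto_of_mem_projSet (hne _ hi _ hYsmem _ (hYsc _ h1m))
        (fun k => hLU _ hi (hYmem k)) (fun k => hYc k _ h1m) hlim
    · exact (hchain (m - n) n (by omega) hn).2.2
  refine ⟨htend, tendsto_finsetSum _ fun i hi => ?_,
    Finset.sum_nonneg fun _ _ => norm_nonneg _, fun hgap => ⟨Ys 1, ?_⟩⟩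
  · obtain ⟨h1, him⟩ := Finset.mem_Icc.mp hi
    exact ((htend (i + 1) (Finset.mem_Icc.mpr ⟨by omega, by omega⟩)).sub
      (htend i (Finset.mem_Icc.mpr ⟨h1, by omega⟩))).norm
  · refine Set.mem_iInter₂.mpr fun i hi => ?_
    rw [← eq_of_sum_norm_sub_eq_zero hgap i hi]
    exact (hYsc i hi).1
end
end
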